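/- Let Δ ⊆ ℝ^n be a nonempty closed convex set, Ψ : ℝ^n → ℝ differentiable and σ_Ψ-strongly convex on Δ (D_Ψ(x,y) ≥ (σ_Ψ/2)‖x−y‖² on Δ, where D_Ψ(x,y) = Ψ(x) − Ψ(y) − ⟨∇Ψ(y), x−y⟩), and Φ : ℝ^n → ℝ convex differentiable with a minimizer μ* of Φ over Δ, Φ* = Φ(μ*). Let A > 0, B ≥ 0, φ* ≥ 0 with A Φ* + B ≥ 0 and ‖∇Φ(μ)‖² ≤ A Φ(μ) + B for all μ ∈ Δ. On a probability space with filtration (ℱ_t)_{t≥0}, let (μ^t)_{t≥1} be Δ-valued with μ^t ℱ_{t−1}-measurable, (ℓ^t)_{t≥1} integrable ℝ^n-valued and ℱ_t-measurable, and (φ^t)_{t≥1} integrable nonnegative real-valued and ℱ_t-measurable, such that almost surely for every t: (a) ⟨η_t ℓ^t + ∇Ψ(μ^{t+1}) − ∇Ψ(μ^t), μ^{t+1} − ν⟩ ≤ 0 for all ν ∈ Δ; (b) ‖ℓ^t‖² ≤ A φ^t + B; (c) ⟨μ* − μ^t, ℓ^t⟩ ≤ φ* − φ^t; (d) E[ℓ^t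 | ℱ_{t−1}] = ∇Φ(μ^t) and E[φ^t | ℱ_{t−1}] = Φ(μ^t). Assume 0 < η_{t+1} ≤ η_t ≤ σ_Ψ/(2A), sup_t η_t Σ_{j<t} η_j < ∞, Σ_t η_t² < ∞, and D_Ψ(μ*, μ^1) ≤ a† almost surely. Then there exists a finite constant C₃, not depending on T or δ, such that for every integer T ≥ 2 and every δ ∈ (0,1), with μ̄^T = (Σ_{k=1}^T η_k μ^k)/(Σ_{k=1}^T η_k): P( Φ(μ̄^T) − Φ* ≤ C₃ · log^{3/2}(2T/δ) / Σ_{k=1}^T η_k ) ≥ 1 − δ. -/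

import Mathlib

open MeasureTheory
open scoped RealInnerProductSpace

lemma aux_exp_le {x : ℝ} (hx : x ≤ 1) : Real.exp x ≤ 1 + x + x ^ 2 := by
  by_cases h : -1 ≤ x
  · have := (abs_le.1 (Real.abs_exp_sub_one_sub_id_le (abs_le.2 ⟨h, hx⟩))).2
    linarith
  · push Not at h
    have : Real.exp x ≤ 1 := Real.exp_le_one_iff.2 (by linarith)
    nlinarith

lemma aux_grad_ineq {E : Type*} [NormedAddCommGroup E] [InnerProductSpace ℝ E] [CompleteSpace E]
    {f : E → ℝ} (hf : ConvexOn ℝ Set.univ f) {x g : E} (hg : HasGradientAt f g x) (y : E) :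
    f x + ⟪g, y - x⟫ ≤ f y := by
  have h1 : ConvexOn ℝ Set.univ (f ∘ (AffineMap.lineMap x y : ℝ →ᵃ[ℝ] E)) := by
    simpa using hf.comp_affineMap (AffineMap.lineMap x y : ℝ →ᵃ[ℝ] E)
  have h2 : HasDerivAt (f ∘ (AffineMap.lineMap x y : ℝ →ᵃ[ℝ] E)) ⟪g, y - x⟫ 0 := by
    have h3 := hg.hasFDerivAt
    have h4 : HasDerivAt (AffineMap.lineMap x y : ℝ → E) (y - x) 0 := AffineMap.hasDerivAt_lineMap
    have := HasFDerivAt.comp_hasDerivAt (0 : ℝ) (by simpa using h3) h4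
    simpa using this
  have := h1.le_slope_of_hasDerivAt (Set.mem_univ _) (Set.mem_univ 1) zero_lt_one h2
  simp [slope_def_field] at this
  linarith

lemma aux_meas_grad {E : Type*} [NormedAddCommGroup E] [InnerProductSpace ℝ E] [CompleteSpace E]
    [MeasurableSpace E] [BorelSpace E]
    {f : E → ℝ} {g : E → E} (hg : ∀ x, HasGradientAt f (g x) x) : Measurable g := by
  have : g = fun x => (InnerProductSpace.toDual ℝ E).symm (fderiv ℝ f x) := by
    funext x
    rw [(hg x).hasFDerivAt.fderiv]; simp
  rw [this]
  exact (InnerProductSpace.toDual ℝ E).symm.continuous.measurable.comp (measurable_fderiv ℝ f)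

lemma aux_pull {E : Type*} [NormedAddCommGroup E] [InnerProductSpace ℝ E] [CompleteSpace E]
    {Ω : Type*} {m m0 : MeasurableSpace Ω} {P : Measure Ω} [IsProbabilityMeasure P] (hm : m ≤ m0)
    {f g v : Ω → E} (hf : Integrable f P) (hfg : P[f|m] =ᵐ[P] g)
    (hv : StronglyMeasurable[m] v) {b : ℝ} (hb : ∀ᵐ ω ∂P, ‖v ω‖ ≤ b) :
    Integrable (fun ω => ⟪f ω, v ω⟫) P ∧ Integrable (fun ω => ⟪g ω, v ω⟫) P ∧
    ∫ ω, ⟪f ω, v ω⟫ ∂P = ∫ ω, ⟪g ω, v ω⟫ ∂P := by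
  have key : ∀ u : Ω → E, Integrable u P → Integrable (fun ω => ⟪u ω, v ω⟫) P := by
    intro u hu
    refine Integrable.mono' (hu.norm.mul_const b)
      (hu.aestronglyMeasurable.inner (hv.mono hm).aestronglyMeasurable) ?_
    filter_upwards [hb] with ω h
    exact (norm_inner_le_norm _ _).trans (by gcongr)
  have hg : Integrable g P := integrable_condExp.congr hfg
  refine ⟨key f hf, key g hg, ?_⟩
  have h := condExp_bilin_of_stronglyMeasurable_right (m := m) (μ := P) (innerSL ℝ) hv
    (key f hf) hf
  rw [← integral_condExp hm (f := fun ω => ⟪f ω, v ω⟫)]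
  apply integral_congr_ae
  filter_upwards [h, hfg] with ω h1 h2
  rw [← h2]
  exact h1

lemma aux_step {E : Type*} [NormedAddCommGroup E] [InnerProductSpace ℝ E]
    {Ψ : E → ℝ} {gΨ : E → E} {D : E → E → ℝ}
    (hD : ∀ x y, D x y = Ψ x - Ψ y - ⟪gΨ y, x - y⟫) {σ η : ℝ} (hσ : 0 < σ)
    {s u u' l : E} (hs : σ / 2 * ‖u' - u‖ ^ 2 ≤ D u' u)
    (h : ⟪η • l + gΨ u' - gΨ u, u' - s⟫ ≤ 0) :
    D s u' ≤ D s u + η * ⟪s - u, l⟫ + η ^ 2 * ‖l‖ ^ 2 / (2 * σ) := by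
  have h1 : D s u' - D s u + D u' u = ⟪gΨ u' - gΨ u, u' - s⟫ := by
    rw [hD, hD, hD]
    simp only [inner_sub_left, inner_sub_right]
    ring
  have h2 : ⟪η • l + gΨ u' - gΨ u, u' - s⟫ = η * ⟪l, u' - u⟫ - η * ⟪s - u, l⟫
      + ⟪gΨ u' - gΨ u, u' - s⟫ := by
    simp only [inner_sub_left, inner_sub_right, inner_add_left, real_inner_smul_left]
    rw [real_inner_comm s l, real_inner_comm u l]
    ring
  have h3 : -(η * ⟪l, u' - u⟫) ≤ σ / 2 * ‖u' - u‖ ^ 2 + η ^ 2 * ‖l‖ ^ 2 / (2 * σ) := by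
    have h4 : (0 : ℝ) ≤ ‖η • l + σ • (u' - u)‖ ^ 2 := sq_nonneg _
    rw [norm_add_sq_real, norm_smul, norm_smul, real_inner_smul_left, real_inner_smul_right,
      mul_pow, mul_pow, Real.norm_eq_abs, Real.norm_eq_abs, sq_abs, sq_abs] at h4
    have h5 : σ / 2 * ‖u' - u‖ ^ 2 + η ^ 2 * ‖l‖ ^ 2 / (2 * σ) + η * ⟪l, u' - u⟫ =
      (η ^ 2 * ‖l‖ ^ 2 + 2 * (η * (σ * ⟪l, u' - u⟫)) + σ ^ 2 * ‖u' - u‖ ^ 2) / (2 * σ) := by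
      field_simp
      ring
    have h6 : 0 ≤ (η ^ 2 * ‖l‖ ^ 2 + 2 * (η * (σ * ⟪l, u' - u⟫)) + σ ^ 2 * ‖u' - u‖ ^ 2) / (2 * σ) :=
      div_nonneg h4 (by positivity)
    linarith
  linarith

lemma aux_Zle {η σ A B φs φ p : ℝ} (hη : 0 < η) (hσ : 0 < σ) (hA : 0 < A)
    (hησ : η ≤ σ / (2 * A)) (hφ : 0 ≤ φ) (hp : p ≤ φs - φ) :
    η * p + η ^ 2 * (A * φ + B) / (2 * σ) ≤ η * φs + η ^ 2 * B / (2 * σ) - 3 / 4 * (η * φ) := by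
  have h1 : η * A / (2 * σ) ≤ 1 / 4 := by
    rw [le_div_iff₀ (by positivity)] at hησ
    rw [div_le_iff₀ (by positivity)]
    linarith
  have h2 : η ^ 2 * (A * φ + B) / (2 * σ) = (η * A / (2 * σ)) * (η * φ) + η ^ 2 * B / (2 * σ) := by
    ring
  have h3 : (η * A / (2 * σ)) * (η * φ) ≤ 1 / 4 * (η * φ) := by gcongr
  have h4 : η * p ≤ η * (φs - φ) := by gcongr
  rw [h2]
  linarith

lemma aux_Zsq {η η1 σ A B φs φ p N D : ℝ} (hη : 0 < η) (hη1 : η ≤ η1) (hσ : 0 < σ) (hA : 0 < A)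
    (hB : 0 ≤ B) (hφs : 0 ≤ φs)
    (hησ : η ≤ σ / (2 * A)) (hφ : 0 ≤ φ) (hp : p ≤ φs - φ)
    (hpN : p ^ 2 ≤ (A * φ + B) * N) (hN : σ / 2 * N ≤ D) (hD : 0 ≤ D)
    (hD' : 0 ≤ D + (η * p + η ^ 2 * (A * φ + B) / (2 * σ))) :
    (η * p + η ^ 2 * (A * φ + B) / (2 * σ)) ^ 2 ≤
      (4 / σ + η1 * (4 / 3 * A * (1 + (η1 * φs + η1 ^ 2 * B / (2 * σ))) + η1 * B) / (2 * σ ^ 2))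
        * η ^ 2 * (A * φ + B) * (D + 1) := by
  have hZ := aux_Zle (B := B) hη hσ hA hησ hφ hp
  set q := A * φ + B with hq
  have hq0 : 0 ≤ q := by positivity
  set K := η1 * φs + η1 ^ 2 * B / (2 * σ) with hK
  have hη10 : 0 < η1 := lt_of_lt_of_le hη hη1
  have hK0 : 0 ≤ K := by positivity
  have h1 : η * φs + η ^ 2 * B / (2 * σ) ≤ K := by rw [hK]; gcongr
  have h2 : η * φ ≤ 4 / 3 * (D + K) := by linarith
  have h3 : η * q ≤ (4 / 3 * A * (1 + K) + η1 * B) * (D + 1) := by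
    have e1 : η * q = A * (η * φ) + η * B := by rw [hq]; ring
    have e2 : A * (η * φ) ≤ A * (4 / 3 * (D + K)) := by gcongr
    have e3 : η * B ≤ η1 * B := by gcongr
    have e4 : 0 ≤ A * K * D := by positivity
    have e5 : 0 ≤ η1 * B * D := by positivity
    nlinarith
  set c3 := 4 / 3 * A * (1 + K) + η1 * B with hc3
  have hc30 : 0 ≤ c3 := by positivity
  have h4 : p ^ 2 ≤ q * (2 / σ * (D + 1)) := by
    refine hpN.trans ?_
    gcongr
    rw [div_mul_eq_mul_div, le_div_iff₀ hσ]
    linarith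
  calc (η * p + η ^ 2 * q / (2 * σ)) ^ 2 ≤ 2 * (η * p) ^ 2 + 2 * (η ^ 2 * q / (2 * σ)) ^ 2 := by
        nlinarith [sq_nonneg (η * p - η ^ 2 * q / (2 * σ))]
    _ = 2 * η ^ 2 * p ^ 2 + η ^ 2 * q * (η * (η * q)) / (2 * σ ^ 2) := by
        field_simp
    _ ≤ 2 * η ^ 2 * (q * (2 / σ * (D + 1))) + η ^ 2 * q * (η1 * (c3 * (D + 1))) / (2 * σ ^ 2) := by
        gcongr
    _ = _ := by ring

lemma aux_mgf {lam η σ A b g c1 c2 D p : ℝ} (hl : 0 ≤ lam) (hl1 : lam ≤ 1) (hη : 0 < η) (hσ : 0 < σ)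
    (hA : 0 < A) (hησ : η ≤ σ / (2 * A)) (hg : 0 ≤ g) (hb : 0 ≤ b) (hc1 : 0 ≤ c1) (hD : 0 ≤ D)
    (hc2 : η * (D + 1) ≤ c2) (hlc : lam * (c1 * c2 * A) ≤ 1 / 4) (hp : p ≤ -g) :
    1 + lam * (η * p + η ^ 2 * (A * g + b) / (2 * σ)) + lam ^ 2 * (c1 * η ^ 2 * (A * g + b) * (D + 1))
      ≤ Real.exp (-(lam / 2 * η * g) + lam * (b / (2 * σ) + c1 * b) * η ^ 2 * (D + 1)) := by
  have h1 : η * A / (2 * σ) ≤ 1 / 4 := by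
    rw [le_div_iff₀ (by positivity)] at hησ
    rw [div_le_iff₀ (by positivity)]
    linarith
  refine le_trans ?_ (Real.add_one_le_exp _)
  have e1 : lam * (η * p) ≤ lam * (η * (-g)) := by gcongr
  have e2 : lam * (η ^ 2 * (A * g + b) / (2 * σ)) =
      lam * η * g * (η * A / (2 * σ)) + lam * (b / (2 * σ)) * η ^ 2 := by ring
  have e3 : lam * η * g * (η * A / (2 * σ)) ≤ lam * η * g * (1 / 4) := by gcongr
  have e4 : lam ^ 2 * (c1 * η ^ 2 * (A * g + b) * (D + 1)) =
      lam * η * g * (lam * (c1 * (η * (D + 1)) * A)) + lam * (lam * (c1 * b * η ^ 2 * (D + 1))) := by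
    ring
  have e5 : lam * η * g * (lam * (c1 * (η * (D + 1)) * A)) ≤ lam * η * g * (1 / 4) := by
    gcongr
    exact le_trans (by gcongr) hlc
  have e6 : lam * (lam * (c1 * b * η ^ 2 * (D + 1))) ≤ lam * (1 * (c1 * b * η ^ 2 * (D + 1))) := by
    gcongr
  have e7 : lam * (b / (2 * σ)) * η ^ 2 ≤ lam * (b / (2 * σ)) * η ^ 2 * (D + 1) :=
    le_mul_of_one_le_right (by positivity) (by linarith)
  linarith

/-- strongly measurable and a.e. bounded -/
def AuxBM {Ω E : Type*} [NormedAddCommGroup E] (m : MeasurableSpace Ω) {m0 : MeasurableSpace Ω}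
    (P : Measure Ω) (f : Ω → E) : Prop :=
  StronglyMeasurable[m] f ∧ ∃ b : ℝ, ∀ᵐ ω ∂P, ‖f ω‖ ≤ b

lemma AuxBM.comp {Ω E F : Type*} [NormedAddCommGroup E] [NormedAddCommGroup F] [ProperSpace E]
    {m m0 : MeasurableSpace Ω} {P : Measure Ω} {f : Ω → E}
    (hf : AuxBM m P f) {h : E → F} (hh : Continuous h) : AuxBM m P (fun ω => h (f ω)) := by
  obtain ⟨h1, b, hb⟩ := hf
  refine ⟨hh.comp_stronglyMeasurable h1, ?_⟩
  obtain ⟨C, hC⟩ := (isCompact_closedBall (0 : E) b).exists_bound_of_continuousOn hh.continuousOn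
  refine ⟨C, ?_⟩
  filter_upwards [hb] with ω h
  exact hC _ (by simpa using h)

lemma AuxBM.prod {Ω E F : Type*} [NormedAddCommGroup E] [NormedAddCommGroup F]
    {m m0 : MeasurableSpace Ω} {P : Measure Ω} {f : Ω → E} {g : Ω → F}
    (hf : AuxBM m P f) (hg : AuxBM m P g) : AuxBM m P (fun ω => (f ω, g ω)) := by
  obtain ⟨h1, b, hb⟩ := hf
  obtain ⟨h2, c, hc⟩ := hg
  refine ⟨h1.prodMk h2, max b c, ?_⟩
  filter_upwards [hb, hc] with ω h h'
  exact max_le_max h h'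

lemma AuxBM.sum {Ω : Type*} {m m0 : MeasurableSpace Ω} {P : Measure Ω} {f : ℕ → Ω → ℝ}
    {s : Finset ℕ} (hf : ∀ i ∈ s, AuxBM m P (f i)) : AuxBM m P (fun ω => ∑ i ∈ s, f i ω) := by
  classical
  induction s using Finset.induction_on with
  | empty => exact ⟨by simpa using stronglyMeasurable_const, 0, by simp⟩
  | insert a s ha ih =>
    have := ((hf a (by simp)).prod (ih fun i hi => hf i (by simp [hi]))).comp
      (h := fun x : ℝ × ℝ => x.1 + x.2) (by fun_prop)
    simpa [Finset.sum_insert ha] using this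

lemma AuxBM.mono {Ω E : Type*} [NormedAddCommGroup E] {m m' m0 : MeasurableSpace Ω}
    {P : Measure Ω} {f : Ω → E} (hf : AuxBM m P f) (h : m ≤ m') : AuxBM m' P f :=
  ⟨hf.1.mono h, hf.2⟩

lemma AuxBM.integrable {Ω E : Type*} [NormedAddCommGroup E] {m m0 : MeasurableSpace Ω}
    {P : Measure Ω} [IsProbabilityMeasure P] {f : Ω → E} (hf : AuxBM m P f) (h : m ≤ m0) :
    Integrable f P := by
  obtain ⟨h1, b, hb⟩ := hf
  exact Integrable.of_bound (h1.mono h).aestronglyMeasurable b hb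

set_option maxHeartbeats 4000000 in
/-- Proposition 1 of the paper (resilience of mirror descent): there is a
constant `C₃` such that for every horizon `T ≥ 2` and every `δ ∈ (0,1)`, with
probability at least `1 − δ`, the weighted Cesàro average `μ̄^T` of the
post-attack mirror-descent trajectory satisfies
`Φ(μ̄^T) − Φ* ≤ C₃ log^{3/2}(2T/δ) / Σ_{k=1}^T η_k`. -/
theorem md_resilience_wanes
    {n : ℕ} {Ω : Type*} {m0 : MeasurableSpace Ω}
    (P : Measure Ω) [IsProbabilityMeasure P] (ℱ : Filtration ℕ m0)
    (Δ : Set (EuclideanSpace ℝ (Fin n)))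
    (hΔne : Δ.Nonempty) (hΔclosed : IsClosed Δ) (hΔconv : Convex ℝ Δ)
    (Ψ : EuclideanSpace ℝ (Fin n) → ℝ)
    (gΨ : EuclideanSpace ℝ (Fin n) → EuclideanSpace ℝ (Fin n))
    (hΨ : ∀ x, HasGradientAt Ψ (gΨ x) x)
    (D : EuclideanSpace ℝ (Fin n) → EuclideanSpace ℝ (Fin n) → ℝ)
    (hD : ∀ x y, D x y = Ψ x - Ψ y - ⟪gΨ y, x - y⟫)
    (σΨ : ℝ) (hσΨ : 0 < σΨ)
    (hstrong : ∀ x ∈ Δ, ∀ y ∈ Δ, σΨ / 2 * ‖x - y‖ ^ 2 ≤ D x y)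
    (Φ : EuclideanSpace ℝ (Fin n) → ℝ)
    (gΦ : EuclideanSpace ℝ (Fin n) → EuclideanSpace ℝ (Fin n))
    (hΦconv : ConvexOn ℝ Set.univ Φ)
    (hΦgrad : ∀ x, HasGradientAt Φ (gΦ x) x)
    (μstar : EuclideanSpace ℝ (Fin n)) (hμstar : μstar ∈ Δ)
    (hmin : ∀ ν ∈ Δ, Φ μstar ≤ Φ ν)
    (Φstar : ℝ) (hΦstar : Φstar = Φ μstar)
    (A B φstar : ℝ) (hA : 0 < A) (hB : 0 ≤ B) (hφstar : 0 ≤ φstar)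
    (hABΦ : 0 ≤ A * Φstar + B)
    (hgrowthΦ : ∀ ν ∈ Δ, ‖gΦ ν‖ ^ 2 ≤ A * Φ ν + B)
    (μ : ℕ → Ω → EuclideanSpace ℝ (Fin n))
    (ℓ : ℕ → Ω → EuclideanSpace ℝ (Fin n))
    (φ : ℕ → Ω → ℝ) (η : ℕ → ℝ)
    (hμΔ : ∀ t ≥ 1, ∀ ω, μ t ω ∈ Δ)
    (hμmeas : ∀ t ≥ 1, StronglyMeasurable[ℱ (t - 1)] (μ t))
    (hℓmeas : ∀ t ≥ 1, StronglyMeasurable[ℱ t] (ℓ t))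
    (hℓint : ∀ t ≥ 1, Integrable (ℓ t) P)
    (hφmeas : ∀ t ≥ 1, StronglyMeasurable[ℱ t] (φ t))
    (hφint : ∀ t ≥ 1, Integrable (φ t) P)
    (hφpos : ∀ t ≥ 1, ∀ ω, 0 ≤ φ t ω)
    (habc : ∀ᵐ ω ∂P, ∀ t ≥ 1,
      (∀ ν ∈ Δ, ⟪η t • ℓ t ω + gΨ (μ (t + 1) ω) - gΨ (μ t ω), μ (t + 1) ω - ν⟫ ≤ 0) ∧
      ‖ℓ t ω‖ ^ 2 ≤ A * φ t ω + B ∧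
      ⟪μstar - μ t ω, ℓ t ω⟫ ≤ φstar - φ t ω)
    (hcondℓ : ∀ t ≥ 1, P[ℓ t|ℱ (t - 1)] =ᵐ[P] fun ω => gΦ (μ t ω))
    (hcondφ : ∀ t ≥ 1, P[φ t|ℱ (t - 1)] =ᵐ[P] fun ω => Φ (μ t ω))
    (hηpos : ∀ t ≥ 1, 0 < η t)
    (hηdec : ∀ t ≥ 1, η (t + 1) ≤ η t)
    (hηle : ∀ t ≥ 1, η t ≤ σΨ / (2 * A))
    (hηprod : ∃ c : ℝ, ∀ t ≥ 1, η t * ∑ j ∈ Finset.Ico 1 t, η j ≤ c)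
    (hηsq : Summable fun t => η t ^ 2)
    (adag : ℝ) (hadag : ∀ᵐ ω ∂P, D μstar (μ 1 ω) ≤ adag) :
    ∃ C₃ : ℝ, ∀ T : ℕ, 2 ≤ T → ∀ δ : ℝ, 0 < δ → δ < 1 →
      ENNReal.ofReal (1 - δ) ≤
        P {ω | Φ ((∑ k ∈ Finset.Icc 1 T, η k)⁻¹ •
              ∑ k ∈ Finset.Icc 1 T, η k • μ k ω) - Φstar ≤
            C₃ * Real.log (2 * T / δ) ^ ((3 : ℝ) / 2) /
              ∑ k ∈ Finset.Icc 1 T, η k} := by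
  classical
  have hadag0 : 0 ≤ adag := by
    obtain ⟨ω, hω⟩ := hadag.exists
    refine le_trans ?_ hω
    exact le_trans (by positivity) (hstrong _ hμstar _ (hμΔ 1 le_rfl ω))
  have hDpos : ∀ t ≥ 1, ∀ ω, 0 ≤ D μstar (μ t ω) := fun t ht ω =>
    le_trans (by positivity) (hstrong _ hμstar _ (hμΔ t ht ω))
  obtain ⟨c, hc⟩ := hηprod
  have hc0 : 0 ≤ c := by simpa using hc 1 le_rfl
  have hη1 : ∀ t ≥ 1, η t ≤ η 1 := by
    intro t ht
    induction t, ht using Nat.le_induction with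
    | base => exact le_rfl
    | succ k hk ih => exact (hηdec k hk).trans ih
  have hη10 : 0 < η 1 := hηpos 1 le_rfl
  set Ssq := ∑' t, η t ^ 2 with hSsq
  have hSle : ∀ t, ∑ j ∈ Finset.Ico 1 t, η j ^ 2 ≤ Ssq := fun t =>
    hηsq.sum_le_tsum _ (fun i _ => sq_nonneg _)
  have hSsq0 : 0 ≤ Ssq := tsum_nonneg fun _ => sq_nonneg _
  -- pathwise step
  have hstep : ∀ᵐ ω ∂P, ∀ t ≥ 1, D μstar (μ (t + 1) ω) ≤ D μstar (μ t ω) +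
      (η t * ⟪μstar - μ t ω, ℓ t ω⟫ + η t ^ 2 * (A * φ t ω + B) / (2 * σΨ)) := by
    filter_upwards [habc] with ω h t ht
    obtain ⟨ha, hb, -⟩ := h t ht
    have h1 := aux_step hD hσΨ (hstrong _ (hμΔ (t + 1) (by omega) ω) _ (hμΔ t ht ω)) (ha _ hμstar)
    have h2 : η t ^ 2 * ‖ℓ t ω‖ ^ 2 / (2 * σΨ) ≤ η t ^ 2 * (A * φ t ω + B) / (2 * σΨ) := by
      gcongr
    linarith
  have hDbd : ∀ᵐ ω ∂P, ∀ t ≥ 1, D μstar (μ t ω) ≤ adag + φstar * ∑ j ∈ Finset.Ico 1 t, η j +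
      B / (2 * σΨ) * ∑ j ∈ Finset.Ico 1 t, η j ^ 2 := by
    filter_upwards [habc, hstep, hadag] with ω h h1 h2 t ht
    induction t, ht using Nat.le_induction with
    | base => simpa using h2
    | succ k hk ih =>
      have h3 := h1 k hk
      have h4 := aux_Zle (B := B) (hηpos k hk) hσΨ hA (hηle k hk) (hφpos k hk ω) (h k hk).2.2
      have h5 : 0 ≤ η k * φ k ω := mul_nonneg (hηpos k hk).le (hφpos k hk ω)
      rw [Finset.sum_Ico_succ_top hk, Finset.sum_Ico_succ_top hk]
      have h6 : η k ^ 2 * B / (2 * σΨ) = B / (2 * σΨ) * η k ^ 2 := by ring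
      linarith
  obtain ⟨c2, hc2def⟩ : ∃ c2, c2 = η 1 * (adag + B / (2 * σΨ) * Ssq + 1) + φstar * c := ⟨_, rfl⟩
  have hc20 : 0 ≤ c2 := by rw [hc2def]; positivity
  have hc2 : ∀ᵐ ω ∂P, ∀ t ≥ 1, η t * (D μstar (μ t ω) + 1) ≤ c2 := by
    filter_upwards [hDbd] with ω h t ht
    have h0 := (hηpos t ht).le
    have h1 : η t * (D μstar (μ t ω) + 1) ≤ η t * (adag + φstar * ∑ j ∈ Finset.Ico 1 t, η j +
      B / (2 * σΨ) * Ssq + 1) := by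
      gcongr
      refine (h t ht).trans ?_
      gcongr
      exact hSle t
    have h2 : η t * (adag + B / (2 * σΨ) * Ssq + 1) ≤ η 1 * (adag + B / (2 * σΨ) * Ssq + 1) := by
      gcongr
      exact hη1 t ht
    have h3 : φstar * (η t * ∑ j ∈ Finset.Ico 1 t, η j) ≤ φstar * c := by
      gcongr
      exact hc t ht
    rw [hc2def]
    linarith
  obtain ⟨K, hK⟩ : ∃ K, K = η 1 * φstar + η 1 ^ 2 * B / (2 * σΨ) := ⟨_, rfl⟩
  have hK0 : 0 ≤ K := by rw [hK]; positivity
  obtain ⟨c1, hc1⟩ : ∃ c1, c1 = 4 / σΨ + η 1 * (4 / 3 * A * (1 + K) + η 1 * B) / (2 * σΨ ^ 2) :=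
    ⟨_, rfl⟩
  have hc10 : 0 ≤ c1 := by rw [hc1]; positivity
  obtain ⟨b, hb⟩ : ∃ b, b = A * Φstar + B := ⟨_, rfl⟩
  have hb0 : 0 ≤ b := by rw [hb]; exact hABΦ
  obtain ⟨κ, hκ⟩ : ∃ κ, κ = b / (2 * σΨ) + c1 * b := ⟨_, rfl⟩
  have hκ0 : 0 ≤ κ := by rw [hκ]; positivity
  obtain ⟨lam0, hlam0, hlam1, hlamK, hlamc⟩ : ∃ l : ℝ, 0 < l ∧ l ≤ 1 ∧ l * K ≤ 1 ∧
      l * (c1 * c2 * A) ≤ 1 / 4 := by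
    have h0 : 0 ≤ c1 * c2 * A := by positivity
    refine ⟨1 / (1 + K + 4 * (c1 * c2 * A)), by positivity, ?_, ?_, ?_⟩
    · rw [div_le_iff₀ (by positivity)]; linarith
    · rw [div_mul_eq_mul_div, div_le_iff₀ (by positivity)]; linarith
    · rw [div_mul_eq_mul_div, div_le_iff₀ (by positivity)]; linarith
  obtain ⟨Λ, hΛ⟩ : ∃ Λ : ℕ → ℝ, ∀ t, Λ t = lam0 * Real.exp (-(κ * ∑ j ∈ Finset.Ico 1 t, η j ^ 2)) :=
    ⟨_, fun _ => rfl⟩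
  have hΛpos : ∀ t, 0 < Λ t := fun t => by rw [hΛ]; positivity
  have hΛle : ∀ t, Λ t ≤ lam0 := fun t => by
    rw [hΛ]
    refine mul_le_of_le_one_right hlam0.le (Real.exp_le_one_iff.2 ?_)
    have : 0 ≤ κ * ∑ j ∈ Finset.Ico 1 t, η j ^ 2 :=
      mul_nonneg hκ0 (Finset.sum_nonneg fun _ _ => sq_nonneg _)
    linarith
  have hΛge : ∀ t, lam0 * Real.exp (-(κ * Ssq)) ≤ Λ t := fun t => by
    rw [hΛ]
    gcongr
    exact hSle t
  have hΛstep : ∀ t ≥ 1, Λ (t + 1) * (1 + κ * η t ^ 2) ≤ Λ t := by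
    intro t ht
    rw [hΛ, hΛ, Finset.sum_Ico_succ_top ht, mul_add κ, neg_add, Real.exp_add]
    have h1 : 1 + κ * η t ^ 2 ≤ Real.exp (κ * η t ^ 2) := by
      rw [add_comm]; exact Real.add_one_le_exp _
    have h2 : Real.exp (-(κ * η t ^ 2)) * (1 + κ * η t ^ 2) ≤ 1 := by
      calc _ ≤ Real.exp (-(κ * η t ^ 2)) * Real.exp (κ * η t ^ 2) := by gcongr
        _ = 1 := by rw [← Real.exp_add]; simp
    calc _ = lam0 * Real.exp (-(κ * ∑ j ∈ Finset.Ico 1 t, η j ^ 2)) *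
          (Real.exp (-(κ * η t ^ 2)) * (1 + κ * η t ^ 2)) := by ring
      _ ≤ lam0 * Real.exp (-(κ * ∑ j ∈ Finset.Ico 1 t, η j ^ 2)) * 1 := by gcongr
      _ = _ := by ring
  obtain ⟨g, hg⟩ : ∃ g : ℕ → Ω → ℝ, ∀ t ω, g t ω = Φ (μ t ω) - Φstar := ⟨_, fun _ _ => rfl⟩
  have hg0 : ∀ t ≥ 1, ∀ ω, 0 ≤ g t ω := fun t ht ω => by
    rw [hg, hΦstar]; linarith [hmin _ (hμΔ t ht ω)]
  obtain ⟨G, hG⟩ : ∃ G : ℕ → Ω → ℝ, ∀ t ω, G t ω =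
    ∑ j ∈ Finset.Ico 1 t, Λ (j + 1) / 2 * η j * g j ω := ⟨_, fun _ _ => rfl⟩
  obtain ⟨W, hW⟩ : ∃ W : ℕ → Ω → ℝ, ∀ t ω, W t ω =
    Real.exp (Λ t * D μstar (μ t ω) + G t ω) := ⟨_, fun _ _ => rfl⟩
  -- measurability and boundedness
  have hμBM : ∀ t ≥ 1, AuxBM (ℱ (t - 1)) P (μ t) := by
    intro t ht
    refine ⟨hμmeas t ht, ?_⟩
    obtain ⟨d, hd⟩ : ∃ d : ℝ, ∀ᵐ ω ∂P, D μstar (μ t ω) ≤ d := ⟨_, by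
      filter_upwards [hDbd] with ω h using h t ht⟩
    refine ⟨‖μstar‖ + (2 / σΨ * d + 1), ?_⟩
    filter_upwards [hd] with ω h
    have h1 := hstrong _ hμstar _ (hμΔ t ht ω)
    have h2 : ‖μstar - μ t ω‖ ^ 2 ≤ 2 / σΨ * d := by
      rw [div_mul_eq_mul_div, le_div_iff₀ hσΨ]
      linarith
    have h3 : ‖μstar - μ t ω‖ ≤ 2 / σΨ * d + 1 := by nlinarith [norm_nonneg (μstar - μ t ω)]
    have h4 : ‖μ t ω‖ ≤ ‖μstar‖ + ‖μstar - μ t ω‖ := by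
      have := norm_sub_le μstar (μstar - μ t ω)
      simpa using this
    linarith
  have hΨc : Continuous Ψ := continuous_iff_continuousAt.2 fun x => (hΨ x).hasFDerivAt.continuousAt
  have hΦc : Continuous Φ :=
    continuous_iff_continuousAt.2 fun x => (hΦgrad x).hasFDerivAt.continuousAt
  have hDBM : ∀ t ≥ 1, AuxBM (ℱ (t - 1)) P (fun ω => D μstar (μ t ω)) := by
    intro t ht
    refine ⟨?_, ?_⟩
    · have hm : Measurable (fun y => D μstar y) := by
        have := aux_meas_grad hΨ
        simp only [hD]
        exact (measurable_const.sub hΨc.measurable).sub (this.inner (measurable_const.sub measurable_id))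
      exact (hm.comp (hμmeas t ht).measurable).stronglyMeasurable
    · exact ⟨_, by
        filter_upwards [hDbd] with ω h
        rw [Real.norm_of_nonneg (hDpos t ht ω)]
        exact h t ht⟩
  have hgBM : ∀ t ≥ 1, AuxBM (ℱ (t - 1)) P (g t) := by
    intro t ht
    have := (hμBM t ht).comp (h := fun x => Φ x - Φstar) (by fun_prop)
    convert this using 2
    exact hg _ _
  have hGBM : ∀ t ≥ 1, AuxBM (ℱ (t - 1)) P (G t) := by
    intro t ht
    have : AuxBM (ℱ (t - 1)) P
        (fun ω => ∑ j ∈ Finset.Ico 1 t, Λ (j + 1) / 2 * η j * g j ω) := by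
      apply AuxBM.sum
      intro i hi
      rw [Finset.mem_Ico] at hi
      exact ((hgBM i hi.1).mono (ℱ.mono (by omega))).comp
        (h := fun x => Λ (i + 1) / 2 * η i * x) (by fun_prop)
    convert this using 2
    exact hG _ _
  have hWint : ∀ t ≥ 1, Integrable (W t) P := by
    intro t ht
    have := (((hDBM t ht).prod (hGBM t ht)).comp
      (h := fun x : ℝ × ℝ => Real.exp (Λ t * x.1 + x.2)) (by fun_prop)).integrable (ℱ.le _)
    convert this using 2
    exact hW _ _
  have hWstep : ∀ t ≥ 1, ∫ ω, W (t + 1) ω ∂P ≤ Real.exp (lam0 * κ * η t ^ 2) * ∫ ω, W t ω ∂P := by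
    intro t ht
    have hηt := hηpos t ht
    obtain ⟨lam, hlam⟩ : ∃ l, l = Λ (t + 1) := ⟨_, rfl⟩
    have hl0 : 0 < lam := hlam ▸ hΛpos _
    have hll : lam ≤ lam0 := hlam ▸ hΛle _
    obtain ⟨V, hV⟩ : ∃ V : Ω → ℝ, ∀ ω, V ω =
      Real.exp (lam * D μstar (μ t ω) + G t ω + lam / 2 * η t * g t ω) := ⟨_, fun _ => rfl⟩
    have hV0 : ∀ ω, 0 < V ω := fun ω => by rw [hV]; positivity
    have hVBM : AuxBM (ℱ (t - 1)) P V := by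
      have := (((hDBM t ht).prod (hGBM t ht)).prod (hgBM t ht)).comp
        (h := fun x : (ℝ × ℝ) × ℝ => Real.exp (lam * x.1.1 + x.1.2 + lam / 2 * η t * x.2))
        (by fun_prop)
      convert this using 2
      exact hV _
    have hvBM := (hVBM.prod (hμBM t ht)).comp
      (h := fun x : ℝ × EuclideanSpace ℝ (Fin n) => (x.1 * (lam * η t)) • (μstar - x.2))
      (by fun_prop)
    have hwBM := (hVBM.prod (hDBM t ht)).comp
      (h := fun x : ℝ × ℝ => x.1 * ((lam * η t ^ 2 / (2 * σΨ) + lam ^ 2 * c1 * η t ^ 2 * (x.2 + 1)) * A))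
      (by fun_prop)
    have hrBM := (hVBM.prod (hDBM t ht)).comp
      (h := fun x : ℝ × ℝ =>
        x.1 * (1 + (lam * η t ^ 2 / (2 * σΨ) + lam ^ 2 * c1 * η t ^ 2 * (x.2 + 1)) * B))
      (by fun_prop)
    have hrint := hrBM.integrable (ℱ.le _)
    obtain ⟨hvm, bv, hbv⟩ := hvBM
    obtain ⟨hwm, bw, hbw⟩ := hwBM
    obtain ⟨i1, i2, i3⟩ := aux_pull (ℱ.le (t - 1)) (hℓint t ht) (hcondℓ t ht) hvm hbv
    obtain ⟨j1, j2, j3⟩ := aux_pull (ℱ.le (t - 1)) (hφint t ht) (hcondφ t ht) hwm hbw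
    have hfirst : ∀ᵐ ω ∂P, W (t + 1) ω ≤
        V ω * (1 + (lam * η t ^ 2 / (2 * σΨ) + lam ^ 2 * c1 * η t ^ 2 * (D μstar (μ t ω) + 1)) * B)
        + ⟪ℓ t ω, (V ω * (lam * η t)) • (μstar - μ t ω)⟫
        + ⟪φ t ω, V ω * ((lam * η t ^ 2 / (2 * σΨ) +
            lam ^ 2 * c1 * η t ^ 2 * (D μstar (μ t ω) + 1)) * A)⟫ := by
      filter_upwards [habc, hstep] with ω h1 h2
      obtain ⟨-, hb', hc'⟩ := h1 t ht
      have h3 := h2 t ht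
      have h4 := aux_Zle (B := B) hηt hσΨ hA (hηle t ht) (hφpos t ht ω) hc'
      have hpN : ⟪μstar - μ t ω, ℓ t ω⟫ ^ 2 ≤ (A * φ t ω + B) * ‖μstar - μ t ω‖ ^ 2 := by
        calc ⟪μstar - μ t ω, ℓ t ω⟫ ^ 2 ≤ (‖μstar - μ t ω‖ * ‖ℓ t ω‖) ^ 2 :=
              sq_le_sq' (by linarith [(abs_le.1 (abs_real_inner_le_norm (μstar - μ t ω) (ℓ t ω))).1])
                (real_inner_le_norm _ _)
          _ = ‖ℓ t ω‖ ^ 2 * ‖μstar - μ t ω‖ ^ 2 := by ring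
          _ ≤ _ := by gcongr
      have h5 := aux_Zsq hηt (hη1 t ht) hσΨ hA hB hφstar (hηle t ht) (hφpos t ht ω) hc' hpN
        (hstrong _ hμstar _ (hμΔ t ht ω)) (hDpos t ht ω)
        ((hDpos (t + 1) (by omega) ω).trans h3)
      rw [← hK, ← hc1] at h5
      set Z := η t * ⟪μstar - μ t ω, ℓ t ω⟫ + η t ^ 2 * (A * φ t ω + B) / (2 * σΨ) with hZ
      have hZK : Z ≤ K := by
        have e1 : 0 ≤ η t * φ t ω := mul_nonneg hηt.le (hφpos t ht ω)
        have e2 : η t * φstar + η t ^ 2 * B / (2 * σΨ) ≤ K := by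
          rw [hK]
          have := hη1 t ht
          gcongr
        linarith
      have hlZ : lam * Z ≤ 1 := by
        calc lam * Z ≤ lam * K := by gcongr
          _ ≤ lam0 * K := by gcongr
          _ ≤ 1 := hlamK
      have h6 : Real.exp (lam * Z) ≤ 1 + lam * Z +
          lam ^ 2 * (c1 * η t ^ 2 * (A * φ t ω + B) * (D μstar (μ t ω) + 1)) := by
        refine (aux_exp_le hlZ).trans ?_
        rw [mul_pow]
        gcongr
      have h7 : W (t + 1) ω ≤ V ω * Real.exp (lam * Z) := by
        rw [hW, hV, ← Real.exp_add, ← hlam, hG (t + 1), Finset.sum_Ico_succ_top ht, ← hG, ← hlam]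
        apply Real.exp_le_exp.2
        have : lam * D μstar (μ (t + 1) ω) ≤ lam * (D μstar (μ t ω) + Z) := by gcongr
        linarith
      refine h7.trans ((mul_le_mul_of_nonneg_left h6 (hV0 ω).le).trans (le_of_eq ?_))
      rw [real_inner_smul_right, real_inner_comm (μstar - μ t ω) (ℓ t ω), hZ]
      simp only [RCLike.inner_apply, conj_trivial]
      ring
    have hsecond : ∀ ω, 0 ≤ D μstar (μ t ω) → η t * (D μstar (μ t ω) + 1) ≤ c2 →
        V ω * (1 + (lam * η t ^ 2 / (2 * σΨ) + lam ^ 2 * c1 * η t ^ 2 * (D μstar (μ t ω) + 1)) * B)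
        + ⟪gΦ (μ t ω), (V ω * (lam * η t)) • (μstar - μ t ω)⟫
        + ⟪Φ (μ t ω), V ω * ((lam * η t ^ 2 / (2 * σΨ) +
            lam ^ 2 * c1 * η t ^ 2 * (D μstar (μ t ω) + 1)) * A)⟫ ≤
        Real.exp (lam0 * κ * η t ^ 2) * W t ω := by
      intro ω hD0 hDc
      have hp : ⟪gΦ (μ t ω), μstar - μ t ω⟫ ≤ - g t ω := by
        have := aux_grad_ineq hΦconv (hΦgrad (μ t ω)) μstar
        rw [hg, hΦstar]
        linarith
      have h1 := aux_mgf hl0.le (hll.trans hlam1) hηt hσΨ hA (hηle t ht) (hg0 t ht ω) hb0 hc10 hD0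
        hDc (le_trans (by gcongr) hlamc) hp
      rw [← hκ] at h1
      have h2 : V ω * Real.exp (-(lam / 2 * η t * g t ω) + lam * κ * η t ^ 2 * (D μstar (μ t ω) + 1))
          ≤ Real.exp (lam0 * κ * η t ^ 2) * W t ω := by
        rw [hV, hW, ← Real.exp_add, ← Real.exp_add]
        apply Real.exp_le_exp.2
        have e1 : lam * (1 + κ * η t ^ 2) * D μstar (μ t ω) ≤ Λ t * D μstar (μ t ω) := by
          rw [hlam]
          gcongr
          exact hΛstep t ht
        have e2 : lam * κ * η t ^ 2 ≤ lam0 * κ * η t ^ 2 := by gcongr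
        linarith
      refine le_trans (le_of_eq ?_) ((mul_le_mul_of_nonneg_left h1 (hV0 ω).le).trans h2)
      have e3 : A * g t ω + b = A * Φ (μ t ω) + B := by rw [hg, hb]; ring
      rw [real_inner_smul_right, e3]
      simp only [RCLike.inner_apply, conj_trivial]
      ring
    calc ∫ ω, W (t + 1) ω ∂P ≤ _ := integral_mono_ae (hWint _ (by omega)) ((hrint.add i1).add j1) hfirst
      _ = _ := by
        rw [integral_add' (hrint.add i1) j1, integral_add' hrint i1, i3, j3,
          ← integral_add' hrint i2, ← integral_add' (hrint.add i2) j2]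
      _ ≤ ∫ ω, Real.exp (lam0 * κ * η t ^ 2) * W t ω ∂P := by
        refine integral_mono_ae ((hrint.add i2).add j2) ((hWint t ht).const_mul _) ?_
        filter_upwards [hc2] with ω h
        exact hsecond ω (hDpos t ht ω) (h t ht)
      _ = _ := integral_const_mul _ _
  have hWbd : ∀ t ≥ 1, ∫ ω, W t ω ∂P ≤
      Real.exp (lam0 * adag + lam0 * κ * ∑ j ∈ Finset.Ico 1 t, η j ^ 2) := by
    intro t ht
    induction t, ht using Nat.le_induction with
    | base =>
      have : ∫ ω, W 1 ω ∂P ≤ ∫ ω, Real.exp (lam0 * adag) ∂P := by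
        refine integral_mono_ae (hWint 1 le_rfl) (integrable_const _) ?_
        filter_upwards [hadag] with ω h
        simp only [hW, hG, hΛ, Finset.Ico_self, Finset.sum_empty, mul_zero, neg_zero, Real.exp_zero,
          mul_one, add_zero]
        gcongr
      simpa using this
    | succ k hk ih =>
      refine (hWstep k hk).trans ((mul_le_mul_of_nonneg_left ih (Real.exp_pos _).le).trans ?_)
      rw [← Real.exp_add, Finset.sum_Ico_succ_top hk]
      apply le_of_eq
      congr 1
      ring
  obtain ⟨M, hM⟩ : ∃ M, M = lam0 * adag + lam0 * κ * Ssq := ⟨_, rfl⟩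
  have hM0 : 0 ≤ M := by rw [hM]; positivity
  obtain ⟨li, hli⟩ : ∃ l, l = lam0 * Real.exp (-(κ * Ssq)) := ⟨_, rfl⟩
  have hli0 : 0 < li := by rw [hli]; positivity
  refine ⟨2 / li * (M + 1), ?_⟩
  intro T hT δ hδ hδ1
  have hS0 : 0 < ∑ k ∈ Finset.Icc 1 T, η k :=
    Finset.sum_pos (fun i hi => hηpos i (Finset.mem_Icc.1 hi).1) ⟨1, by simp; omega⟩
  have hmark := mul_meas_ge_le_integral_of_nonneg (μ := P)
    (Filter.Eventually.of_forall fun ω => by simp only [hW]; positivity) (hWint (T + 1) (by omega))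
    (Real.exp M / δ)
  have hWM : ∫ ω, W (T + 1) ω ∂P ≤ Real.exp M := by
    refine (hWbd _ (by omega)).trans ?_
    rw [hM]
    gcongr
    exact hSle _
  have hbad : P {ω | Real.exp M / δ ≤ W (T + 1) ω} ≤ ENNReal.ofReal δ := by
    have h1 : P.real {ω | Real.exp M / δ ≤ W (T + 1) ω} ≤ δ := by
      have h2 := hmark.trans hWM
      rw [div_mul_eq_mul_div, div_le_iff₀ hδ] at h2
      exact le_of_mul_le_mul_left h2 (Real.exp_pos M)
    rw [← ofReal_measureReal]
    exact ENNReal.ofReal_le_ofReal h1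
  rw [ENNReal.ofReal_sub _ hδ.le, ENNReal.ofReal_one]
  refine tsub_le_iff_right.2 ?_
  refine le_trans ?_ (add_le_add_right hbad _)
  refine le_trans ?_ (measure_union_le _ _)
  rw [← measure_univ (μ := P)]
  refine measure_mono ?_
  intro ω _
  rw [Set.mem_union]
  by_cases hω : Real.exp M / δ ≤ W (T + 1) ω
  · exact Or.inr hω
  left
  push Not at hω
  rw [Set.mem_ofPred_eq]
  have hIcc : Finset.Ico 1 (T + 1) = Finset.Icc 1 T := by ext; simp
  have h1 : li / 2 * ∑ k ∈ Finset.Icc 1 T, η k * g k ω < M + Real.log (1 / δ) := by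
    rw [hW] at hω
    have h2 : Real.exp M / δ = Real.exp (M + Real.log (1 / δ)) := by
      rw [Real.exp_add, Real.exp_log (by positivity)]; ring
    rw [h2, Real.exp_lt_exp] at hω
    refine lt_of_le_of_lt ?_ hω
    have h3 : 0 ≤ Λ (T + 1) * D μstar (μ (T + 1) ω) :=
      mul_nonneg (hΛpos _).le (hDpos _ (by omega) ω)
    refine le_trans ?_ (le_add_of_nonneg_left h3)
    rw [hG, hIcc, Finset.mul_sum]
    refine Finset.sum_le_sum fun k hk => ?_
    have hk1 := (Finset.mem_Icc.1 hk).1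
    have e1 := hΛge (k + 1)
    rw [← hli] at e1
    have e2 := hg0 k hk1 ω
    have e3 := hηpos k hk1
    rw [mul_assoc]
    gcongr
  have hlog1 : 1 ≤ Real.log (2 * T / δ) := by
    rw [Real.le_log_iff_exp_le (by positivity)]
    have e1 : (2 : ℝ) ≤ T := by exact_mod_cast hT
    have e2 : (4 : ℝ) ≤ 2 * T / δ := by
      rw [le_div_iff₀ hδ]; nlinarith
    have := Real.exp_one_lt_d9
    linarith
  have hlog2 : Real.log (1 / δ) ≤ Real.log (2 * T / δ) := by
    have e1 : (2 : ℝ) ≤ T := by exact_mod_cast hT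
    apply Real.log_le_log (by positivity)
    gcongr
    linarith
  have hlog3 : Real.log (2 * T / δ) ≤ Real.log (2 * T / δ) ^ ((3 : ℝ) / 2) :=
    Real.self_le_rpow_of_one_le hlog1 (by norm_num)
  have h4 : ∑ k ∈ Finset.Icc 1 T, η k * g k ω ≤
      2 / li * (M + 1) * Real.log (2 * T / δ) ^ ((3 : ℝ) / 2) := by
    have e1 : M + Real.log (1 / δ) ≤ (M + 1) * Real.log (2 * T / δ) ^ ((3 : ℝ) / 2) := by
      nlinarith
    calc _ = 2 / li * (li / 2 * ∑ k ∈ Finset.Icc 1 T, η k * g k ω) := by field_simp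
      _ ≤ 2 / li * ((M + 1) * Real.log (2 * T / δ) ^ ((3 : ℝ) / 2)) := by
        exact mul_le_mul_of_nonneg_left (h1.le.trans e1) (by positivity)
      _ = _ := by ring
  rw [le_div_iff₀ hS0]
  refine le_trans ?_ h4
  set S := ∑ k ∈ Finset.Icc 1 T, η k with hS
  have hJ := hΦconv.map_sum_le (t := Finset.Icc 1 T) (w := fun k => S⁻¹ * η k) (p := fun k => μ k ω)
    (fun i hi => mul_nonneg (inv_nonneg.2 hS0.le) (hηpos i (Finset.mem_Icc.1 hi).1).le)
    (by rw [← Finset.mul_sum, ← hS]; field_simp) (fun _ _ => Set.mem_univ _)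
  have e1 : S⁻¹ • ∑ k ∈ Finset.Icc 1 T, η k • μ k ω =
      ∑ k ∈ Finset.Icc 1 T, (S⁻¹ * η k) • μ k ω := by
    rw [Finset.smul_sum]
    simp only [smul_smul]
  rw [e1]
  have e2 : ∑ k ∈ Finset.Icc 1 T, η k * g k ω =
      S * ∑ k ∈ Finset.Icc 1 T, (S⁻¹ * η k) • Φ (μ k ω) - Φstar * S := by
    rw [Finset.mul_sum, hS, Finset.mul_sum, ← Finset.sum_sub_distrib, ← hS]
    refine Finset.sum_congr rfl fun k _ => ?_
    rw [hg, smul_eq_mul]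
    field_simp
  rw [e2]
  have := mul_le_mul_of_nonneg_left hJ hS0.le
  linarith
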